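/- (Proposition 5.1) The sequence I_{n,0}^B, I_{n,1}^B, …, I_{n,n}^B is not log-concave in general: there exist a positive integer n and an index 1 ≤ k ≤ n−1 such that (I_{n,k}^B)^2 < I_{n,k−1}^B · I_{n,k+1}^B. -/

import Mathlib

open scoped Classical

/-- `Ω_n = {±1, …, ±n}` as a subset of `ℤ`. -/
def OmegaSet (n : ℕ) : Set ℤ := {a : ℤ | 1 ≤ |a| ∧ |a| ≤ (n : ℤ)}

/-- A signed permutation of length `n`: a bijection of `Ω_n` satisfying `w(-a) = -w(a)`,
extended by the identity outside `Ω_n`. -/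
def IsSignedPerm (n : ℕ) (w : ℤ → ℤ) : Prop :=
  (∀ a : ℤ, w (-a) = -w a) ∧ Set.BijOn w (OmegaSet n) (OmegaSet n) ∧
    ∀ a : ℤ, a ∉ OmegaSet n → w a = a

/-- An involution in the hyperoctahedral group `B_n`. -/
def IsSignedInvolution (n : ℕ) (w : ℤ → ℤ) : Prop :=
  IsSignedPerm n w ∧ ∀ a : ℤ, w (w a) = a

/-- The total order `-1 <_r -2 <_r ⋯ <_r 0 <_r 1 <_r 2 <_r ⋯` on `ℤ`. -/
def rlt (a b : ℤ) : Prop :=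
  (a < 0 ∧ b < 0 ∧ b < a) ∨ (a < 0 ∧ 0 ≤ b) ∨ (0 ≤ a ∧ 0 ≤ b ∧ a < b)

/-- `des_B(w) = #{ i ∈ {0,…,n-1} : w(i) >_r w(i+1) }` (with `w(0) = 0`, which is forced by
antisymmetry). -/
noncomputable def desB (n : ℕ) (w : ℤ → ℤ) : ℕ :=
  ((Finset.range n).filter fun i : ℕ => rlt (w ((i : ℤ) + 1)) (w (i : ℤ))).card

/-- `I_{n,k}^B`, the number of involutions `w` in `B_n` with `des_B(w) = k`. -/
noncomputable def InkB (n k : ℕ) : ℕ :=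
  {w : ℤ → ℤ | IsSignedInvolution n w ∧ desB n w = k}.ncard

/-- The odd extension to `ℤ` of the restriction of `G` to nonnegative integers. -/
def oddExt (G : ℤ → ℤ) (x : ℤ) : ℤ := if 0 ≤ x then G x else -G (-x)

theorem oddExt_of_nonneg (G : ℤ → ℤ) {x : ℤ} (hx : 0 ≤ x) : oddExt G x = G x := by
  simp [oddExt, hx]

theorem oddExt_neg {G : ℤ → ℤ} (h0 : G 0 = 0) (x : ℤ) : oddExt G (-x) = -oddExt G x := by
  rcases lt_trichotomy x 0 with h | rfl | h
  · have h1 : ¬ 0 ≤ x := by omega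
    have h2 : x ≤ 0 := by omega
    simp [oddExt, h1, h2]
  · simp [oddExt, h0]
  · have h1 : 0 ≤ x := by omega
    have h2 : ¬ x ≤ 0 := by omega
    simp [oddExt, h1, h2]

theorem mem_OmegaSet_iff {n : ℕ} {x : ℤ} :
    x ∈ OmegaSet n ↔ (1 ≤ x ∧ x ≤ n) ∨ (x ≤ -1 ∧ -(n : ℤ) ≤ x) := by
  simp only [OmegaSet, Set.mem_ofPred_eq]
  rcases abs_cases x with h | h <;> omega

theorem isSignedInvolution_of_involutive {n : ℕ} {w : ℤ → ℤ} (hneg : ∀ x, w (-x) = -w x)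
    (hinv : ∀ x, w (w x) = x) (hmaps : Set.MapsTo w (OmegaSet n) (OmegaSet n))
    (hfix : ∀ x, x ∉ OmegaSet n → w x = x) : IsSignedInvolution n w := by
  refine ⟨⟨hneg, ⟨hmaps, ?_, ?_⟩, hfix⟩, hinv⟩
  · intro x _ y _ h
    rw [← hinv x, h, hinv]
  · exact fun x hx => ⟨w x, hmaps hx, hinv x⟩

theorem isSignedInvolution_oddExt {n : ℕ} {G : ℤ → ℤ} (h0 : G 0 = 0)
    (hinv : ∀ x, 0 < x → (0 < G x ∧ G (G x) = x) ∨ G x = -x)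
    (hle : ∀ x : ℤ, 0 < x → x ≤ n → G x ≤ n) (hfix : ∀ x : ℤ, n < x → G x = x) :
    IsSignedInvolution n (oddExt G) := by
  have hneg := oddExt_neg h0
  have hpos : ∀ x, 0 < x → oddExt G (oddExt G x) = x := by
    intro x hx
    rw [oddExt_of_nonneg G hx.le]
    rcases hinv x hx with ⟨h1, h2⟩ | h
    · rw [oddExt_of_nonneg G h1.le, h2]
    · rw [h, hneg, oddExt_of_nonneg G hx.le, h, neg_neg]
  have hbound : ∀ x : ℤ, 1 ≤ x → x ≤ n → oddExt G x ∈ OmegaSet n := by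
    intro x hx hxn
    rw [oddExt_of_nonneg G (by omega), mem_OmegaSet_iff]
    have := hle x (by omega) hxn
    rcases hinv x (by omega) with h | h <;> omega
  apply isSignedInvolution_of_involutive hneg
  · intro x
    rcases lt_trichotomy x 0 with h | rfl | h
    · have := hpos (-x) (by omega)
      rw [hneg, hneg] at this
      omega
    · simp [oddExt, h0]
    · exact hpos x h
  · intro x hx
    rcases mem_OmegaSet_iff.1 hx with h | h
    · exact hbound x h.1 h.2
    · have := hbound (-x) (by omega) (by omega)
      rw [hneg, mem_OmegaSet_iff] at this
      rw [mem_OmegaSet_iff]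
      omega
  · intro x hx
    rw [mem_OmegaSet_iff] at hx
    rcases lt_trichotomy x 0 with h | rfl | h
    · have := hneg (-x)
      rw [neg_neg, oddExt_of_nonneg G (x := -x) (by omega), hfix (-x) (by omega)] at this
      omega
    · simp [oddExt, h0]
    · rw [oddExt_of_nonneg G h.le, hfix x (by omega)]

theorem finite_setOf_isSignedInvolution (n : ℕ) : {w | IsSignedInvolution n w}.Finite := by
  refine (Set.finite_range fun (g : Set.Icc (-(n : ℤ)) n → Set.Icc (-(n : ℤ)) n) (x : ℤ) =>
    if h : x ∈ Set.Icc (-(n : ℤ)) n then (g ⟨x, h⟩ : ℤ) else x).subset ?_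
  rintro w ⟨⟨-, hb, hfix⟩, -⟩
  have hmaps : ∀ x ∈ Set.Icc (-(n : ℤ)) n, w x ∈ Set.Icc (-(n : ℤ)) n := by
    intro x hx
    by_cases hO : x ∈ OmegaSet n
    · have := mem_OmegaSet_iff.1 (hb.mapsTo hO)
      rw [Set.mem_Icc]
      omega
    · rwa [hfix x hO]
  refine ⟨fun x => ⟨w x, hmaps x x.2⟩, ?_⟩
  funext x
  by_cases h : x ∈ Set.Icc (-(n : ℤ)) n
  · simp only [h, dif_pos]
  · simp only [h, dif_neg, not_false_eq_true]
    refine (hfix x fun hO => h ?_).symm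
    have := mem_OmegaSet_iff.1 hO
    rw [Set.mem_Icc]
    omega

theorem finite_setOf_desB_eq (n k : ℕ) : {w | IsSignedInvolution n w ∧ desB n w = k}.Finite :=
  (finite_setOf_isSignedInvolution n).subset fun _ hw => hw.1

theorem InkB_zero_pos (n : ℕ) : 0 < InkB n 0 := by
  rw [InkB, Set.ncard_pos (finite_setOf_desB_eq n 0)]
  refine ⟨id, isSignedInvolution_of_involutive (fun _ => rfl) (fun _ => rfl)
    (Set.mapsTo_id _) (fun _ _ => rfl), ?_⟩
  rw [desB, Finset.card_eq_zero, Finset.filter_eq_empty_iff]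
  intro i _
  simp only [rlt, id]
  omega

/-- The positive half of a signed involution with at most one descent, at `i`: it exchanges
`[c, i]` with the interval of the same length that starts at `j + 1` and is `-id` on `(i, j]`. -/
def oneDescentHalf (i j c x : ℤ) : ℤ :=
  if x < c then x else if x ≤ i then x - c + j + 1 else if x ≤ j then -x
  else if x ≤ j + (i - c + 1) then x - j - 1 + c else x

theorem sub_le_sub_of_lt_succ {f : ℤ → ℤ} {a b : ℤ}
    (h : ∀ x, a ≤ x → x < b → f x < f (x + 1)) {x y : ℤ} (hax : a ≤ x) (hxy : x ≤ y)
    (hyb : y ≤ b) : y - x ≤ f y - f x := by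
  induction y, hxy using Int.leInduction with
  | base => omega
  | succ y hy ih =>
    have := h y (by omega) (by omega)
    have := ih (by omega)
    omega

theorem exists_eq_oddExt_of_desB_eq_one {n : ℕ} {w : ℤ → ℤ} (hw : IsSignedInvolution n w)
    (hd : desB n w = 1) :
    ∃ i j c : ℕ, i ≤ n ∧ j ≤ n ∧ c ≤ n ∧ oddExt (oneDescentHalf i j c) = w := by
  obtain ⟨⟨hneg, hb, hfix⟩, hinv⟩ := hw
  obtain ⟨i, hi⟩ := Finset.card_eq_one.1 hd
  have hin : i < n := by
    have : i ∈ ({i} : Finset ℕ) := by simp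
    rw [← hi] at this
    simpa using (Finset.mem_filter.1 this).1
  have hinj : ∀ x y, w x = w y → x = y := fun x y h => by rw [← hinv x, h, hinv]
  have hw0 : w 0 = 0 := by have := hneg 0; rw [neg_zero] at this; omega
  have hbd : ∀ x : ℤ, 1 ≤ x → x ≤ n → (1 ≤ w x ∧ w x ≤ n) ∨ (w x ≤ -1 ∧ -(n : ℤ) ≤ w x) :=
    fun x h1 h2 => mem_OmegaSet_iff.1 (hb.mapsTo (mem_OmegaSet_iff.2 (by omega)))
  have hstep : ∀ x : ℤ, 0 ≤ x → x < n → x ≠ i → ¬ rlt (w (x + 1)) (w x) ∧ w x ≠ w (x + 1) := by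
    intro x hx hxn hxi
    refine ⟨fun hr => hxi ?_, fun h => by have := hinj _ _ h; omega⟩
    lift x to ℕ using hx
    have : x ∈ ({i} : Finset ℕ) := by
      rw [← hi, Finset.mem_filter, Finset.mem_range]
      exact ⟨by omega, hr⟩
    simpa using this
  have hnonneg : ∀ x : ℤ, 0 ≤ x → x ≤ i → 0 ≤ w x := by
    intro x hx
    induction x, hx using Int.leInduction with
    | base => intro; omega
    | succ x hx ih =>
      intro hxi
      have := ih (by omega)
      have := hstep x hx (by omega) (by omega)
      simp only [rlt] at this
      omega
  have hA : ∀ x y : ℤ, 0 ≤ x → x ≤ y → y ≤ i → y - x ≤ w y - w x := by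
    intro x y hx hxy hyi
    refine sub_le_sub_of_lt_succ (a := 0) (b := i) (fun z hz hzi => ?_) hx hxy hyi
    have h1 := hnonneg z hz (by omega)
    have h2 := hnonneg (z + 1) (by omega) (by omega)
    have h3 := hstep z hz (by omega) (by omega)
    simp only [rlt] at h3
    omega
  have hex : ∃ j : ℕ, i ≤ j ∧ (j = n ∨ 0 ≤ w (j + 1)) := ⟨n, hin.le, Or.inl rfl⟩
  obtain ⟨j, ⟨hij, hj⟩, hjmin⟩ :
      ∃ j : ℕ, (i ≤ j ∧ (j = n ∨ 0 ≤ w (j + 1))) ∧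
        ∀ k < j, ¬ (i ≤ k ∧ (k = n ∨ 0 ≤ w (k + 1))) :=
    ⟨Nat.find hex, Nat.find_spec hex, fun k hk => Nat.find_min hex hk⟩
  have hjn : j ≤ n := by
    by_contra h
    exact hjmin n (by omega) ⟨by omega, Or.inl rfl⟩
  have hNneg : ∀ x : ℤ, i < x → x ≤ j → w x < 0 := by
    intro x hix hxj
    obtain ⟨k, rfl⟩ : ∃ k : ℕ, x = k + 1 := ⟨(x - 1).toNat, by omega⟩
    by_contra h
    exact hjmin k (by omega) ⟨by omega, Or.inr (by omega)⟩
  have hCpos : ∀ x : ℤ, (j : ℤ) + 1 ≤ x → x ≤ n → 0 < w x := by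
    intro x hx
    induction x, hx using Int.leInduction with
    | base =>
      intro h
      have := hbd (j + 1) (by omega) h
      omega
    | succ x hx ih =>
      intro hxn
      have := ih (by omega)
      have := hstep x (by omega) (by omega) (by omega)
      simp only [rlt] at this
      omega
  have hC : ∀ x y : ℤ, (j : ℤ) + 1 ≤ x → x ≤ y → y ≤ n → y - x ≤ w y - w x := by
    intro x y hx hxy hyn
    refine sub_le_sub_of_lt_succ (a := j + 1) (b := n) (fun z hz hzn => ?_) hx hxy hyn
    have h1 := hCpos z hz (by omega)
    have h2 := hCpos (z + 1) (by omega) (by omega)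
    have h3 := hstep z (by omega) (by omega) (by omega)
    simp only [rlt] at h3
    omega
  have hNmono : ∀ x y : ℤ, (i : ℤ) + 1 ≤ x → x ≤ y → y ≤ j → y - x ≤ -w y - -w x := by
    intro x y hx hxy hyj
    refine sub_le_sub_of_lt_succ (f := fun z => -w z) (a := i + 1) (b := j)
      (fun z hz hzj => ?_) hx hxy hyj
    have h1 := hNneg z (by omega) (by omega)
    have h2 := hNneg (z + 1) (by omega) (by omega)
    have h3 := hstep z (by omega) (by omega) (by omega)
    simp only [rlt] at h3
    show -w z < -w (z + 1)
    omega
  have hNmaps : ∀ x : ℤ, i < x → x ≤ j → i < -w x ∧ -w x ≤ j ∧ w (-w x) = -x := by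
    intro x hx hxj
    have h1 := hNneg x hx hxj
    have h2 : w (-w x) = -x := by rw [hneg, hinv]
    have h3 := hbd x (by omega) (by omega)
    refine ⟨?_, ?_, h2⟩
    · by_contra h
      have := hnonneg (-w x) (by omega) (by omega)
      omega
    · by_contra h
      have := hCpos (-w x) (by omega) (by omega)
      omega
  have hNge : ∀ x : ℤ, i < x → x ≤ j → x ≤ -w x := by
    intro x hx hxj
    have h1 := hNmono (i + 1) x (by omega) (by omega) hxj
    have h2 := hNmaps (i + 1) (by omega) (by omega)
    omega
  have hN : ∀ x : ℤ, i < x → x ≤ j → w x = -x := by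
    intro x hx hxj
    have h1 := hNge x hx hxj
    have h2 := hNmaps x hx hxj
    have h3 := hNge (-w x) h2.1 h2.2.1
    omega
  have hAge : ∀ x : ℤ, 0 ≤ x → x ≤ i → x ≤ w x := by
    intro x hx hxi
    have := hA 0 x le_rfl hx hxi
    omega
  have hCle : ∀ x : ℤ, j < x → x ≤ n → w x ≤ x := by
    intro x hx hxn
    have h1 := hC x n (by omega) hxn le_rfl
    have h2 := hbd n (by omega) le_rfl
    omega
  have hout : ∀ x : ℤ, 0 < w x → ¬ (i < w x ∧ w x ≤ j) ∨ x < 0 := by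
    intro x hx
    by_contra! h
    have := hN (w x) h.1.1 h.1.2
    rw [hinv] at this
    omega
  have hCfix : ∀ x : ℤ, j < x → x ≤ n → i < w x → w x = x := by
    intro x hx hxn hi
    have h1 := hout x (by omega)
    have h2 := hCle x hx hxn
    have h3 := hCle (w x) (by omega) (by omega)
    rw [hinv] at h3
    omega
  have hex' : ∃ c : ℕ, 1 ≤ c ∧ (c = i + 1 ∨ w c ≠ c) := ⟨i + 1, by omega, Or.inl rfl⟩
  obtain ⟨c, ⟨hc1, hc⟩, hcmin⟩ :
      ∃ c : ℕ, (1 ≤ c ∧ (c = i + 1 ∨ w c ≠ c)) ∧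
        ∀ k < c, ¬ (1 ≤ k ∧ (k = i + 1 ∨ w k ≠ k)) :=
    ⟨Nat.find hex', Nat.find_spec hex', fun k hk => Nat.find_min hex' hk⟩
  have hci : c ≤ i + 1 := by
    by_contra h
    exact hcmin (i + 1) (by omega) ⟨by omega, Or.inl rfl⟩
  have hAfix : ∀ x : ℤ, 0 ≤ x → x < c → w x = x := by
    intro x hx hxc
    lift x to ℕ using hx
    by_contra h
    refine hcmin x (by omega) ⟨?_, Or.inr h⟩
    by_contra h0
    obtain rfl : x = 0 := by omega
    exact h hw0
  have hwc : c ≤ i → w c = j + 1 := by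
    intro hci'
    have h1 := hAge c (by omega) (by omega)
    have h2 : w c ≠ c := by omega
    have h3 : i < w c := by
      by_contra h
      have := hAge (w c) (by omega) (by omega)
      rw [hinv] at this
      omega
    have h4 := hout c (by omega)
    have h5 := hbd c (by omega) (by omega)
    have h6 := hC (j + 1) (w c) le_rfl (by omega) (by omega)
    rw [hinv] at h6
    by_contra h7
    have h8 := hCpos (j + 1) le_rfl (by omega)
    have h9 := hAfix (w (j + 1)) (by omega) (by omega)
    rw [hinv] at h9
    omega
  have hAswap : ∀ x : ℤ, c ≤ x → x ≤ i → w x = x - c + j + 1 := by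
    intro x hcx hxi
    have h0 := hwc (by omega)
    have h1 := hA c x (by omega) hcx hxi
    have h2 := hbd x (by omega) (by omega)
    have h3 := hC (x - c + j + 1) (w x) (by omega) (by omega) (by omega)
    have h4 := hC (j + 1) (x - c + j + 1) (by omega) (by omega) (by omega)
    have h5 : w (j + 1) = c := by rw [← h0, hinv]
    rw [hinv] at h3
    omega
  refine ⟨i, j, c, hin.le, hjn, by omega, ?_⟩
  have hzero : oneDescentHalf i j c 0 = 0 := by
    rw [oneDescentHalf, if_pos (by omega)]
  have hhalf : ∀ x : ℤ, 0 ≤ x → oneDescentHalf i j c x = w x := by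
    intro x hx
    unfold oneDescentHalf
    split_ifs with h1 h2 h3 h4
    · exact (hAfix x hx h1).symm
    · exact (hAswap x (by omega) h2).symm
    · exact (hN x (by omega) h3).symm
    · have h5 := hAswap (x - j - 1 + c) (by omega) (by omega)
      rw [show x - (j : ℤ) - 1 + c - c + j + 1 = x by ring] at h5
      rw [← hinv (x - j - 1 + c), h5]
    · by_cases hxn : x ≤ n
      · refine (hCfix x (by omega) hxn ?_).symm
        by_contra h6
        have h7 := hCpos x (by omega) hxn
        rcases lt_or_ge (w x) c with h8 | h8
        · have := hAfix (w x) (by omega) h8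
          rw [hinv] at this
          omega
        · have := hAswap (w x) h8 (by omega)
          rw [hinv] at this
          omega
      · refine (hfix x fun h => ?_).symm
        have := mem_OmegaSet_iff.1 h
        omega
  funext x
  rcases le_total 0 x with hx | hx
  · rw [oddExt_of_nonneg _ hx, hhalf x hx]
  · have h1 := oddExt_neg hzero (-x)
    rw [neg_neg, oddExt_of_nonneg _ (x := -x) (by omega), hhalf (-x) (by omega), hneg] at h1
    omega

theorem InkB_one_le (n : ℕ) : InkB n 1 ≤ (n + 1) ^ 3 := by
  let R := Finset.range (n + 1)
  let F : ℕ × ℕ × ℕ → ℤ → ℤ := fun t => oddExt (oneDescentHalf t.1 t.2.1 t.2.2)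
  have hsub : {w | IsSignedInvolution n w ∧ desB n w = 1} ⊆
      ((R ×ˢ R ×ˢ R).image F : Set (ℤ → ℤ)) := by
    rintro w ⟨hw, hd⟩
    obtain ⟨i, j, c, hi, hj, hc, h⟩ := exists_eq_oddExt_of_desB_eq_one hw hd
    rw [Finset.mem_coe, Finset.mem_image]
    refine ⟨(i, j, c), ?_, h⟩
    simp only [R, Finset.mem_product, Finset.mem_range]
    omega
  calc InkB n 1 ≤ ((R ×ˢ R ×ˢ R).image F : Set (ℤ → ℤ)).ncard :=
        Set.ncard_le_ncard hsub (Finset.finite_toSet _)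
    _ = ((R ×ˢ R ×ˢ R).image F).card := Set.ncard_coe_finset _
    _ ≤ (R ×ˢ R ×ˢ R).card := Finset.card_image_le
    _ = (n + 1) ^ 3 := by
      simp only [R, Finset.card_product, Finset.card_range]
      ring

/-- The positive half of a signed involution with two descents. The positive integers are cut into
intervals of lengths `a, ab, ac | nb, ab, b, bc | nc, ac, bc, ∞`, the bars marking the descents:
the intervals of length `a`, `b`, `∞` are fixed, those of length `nb`, `nc` are negated, and the
two of length `ab` (and likewise `ac`, `bc`) are exchanged by a translation. -/
def twoDescentHalf (a ab ac nb b bc nc x : ℤ) : ℤ :=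
  if x ≤ a then x
  else if x ≤ a + ab then x + (ab + ac + nb)
  else if x ≤ a + ab + ac then x + (ac + nb + ab + b + bc + nc)
  else if x ≤ a + ab + ac + nb then -x
  else if x ≤ a + 2 * ab + ac + nb then x - (ab + ac + nb)
  else if x ≤ a + 2 * ab + ac + nb + b then x
  else if x ≤ a + 2 * ab + ac + nb + b + bc then x + (bc + nc + ac)
  else if x ≤ a + 2 * ab + ac + nb + b + bc + nc then -x
  else if x ≤ a + 2 * ab + 2 * ac + nb + b + bc + nc then x - (ac + nb + ab + b + bc + nc)
  else if x ≤ a + 2 * ab + 2 * ac + nb + b + 2 * bc + nc then x - (bc + nc + ac)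
  else x

theorem twoDescentHalf_cases (a ab ac nb b bc nc x : ℤ) :
    let y := twoDescentHalf a ab ac nb b bc nc x
    (x ≤ a ∧ y = x) ∨
    (a < x ∧ x ≤ a + ab ∧ y = x + (ab + ac + nb)) ∨
    (a + ab < x ∧ x ≤ a + ab + ac ∧ y = x + (ac + nb + ab + b + bc + nc)) ∨
    (a + ab + ac < x ∧ x ≤ a + ab + ac + nb ∧ y = -x) ∨
    (a + ab + ac + nb < x ∧ x ≤ a + 2 * ab + ac + nb ∧ y = x - (ab + ac + nb)) ∨
    (a + 2 * ab + ac + nb < x ∧ x ≤ a + 2 * ab + ac + nb + b ∧ y = x) ∨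
    (a + 2 * ab + ac + nb + b < x ∧ x ≤ a + 2 * ab + ac + nb + b + bc ∧
      y = x + (bc + nc + ac)) ∨
    (a + 2 * ab + ac + nb + b + bc < x ∧ x ≤ a + 2 * ab + ac + nb + b + bc + nc ∧ y = -x) ∨
    (a + 2 * ab + ac + nb + b + bc + nc < x ∧ x ≤ a + 2 * ab + 2 * ac + nb + b + bc + nc ∧
      y = x - (ac + nb + ab + b + bc + nc)) ∨
    (a + 2 * ab + 2 * ac + nb + b + bc + nc < x ∧
      x ≤ a + 2 * ab + 2 * ac + nb + b + 2 * bc + nc ∧ y = x - (bc + nc + ac)) ∨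
    (a + 2 * ab + 2 * ac + nb + b + 2 * bc + nc < x ∧ y = x) := by
  intro y
  have hy : y = twoDescentHalf a ab ac nb b bc nc x := rfl
  clear_value y
  unfold twoDescentHalf at hy
  split at hy
  · exact Or.inl ⟨by assumption, hy⟩
  iterate 9
    right
    split at hy
    · exact Or.inl ⟨by omega, by assumption, hy⟩
  exact Or.inr ⟨by omega, hy⟩

theorem isSignedInvolution_oddExt_twoDescentHalf {n : ℕ} {a ab ac nb b bc nc : ℤ} (ha : 0 < a)
    (hab : 0 < ab) (hac : 0 < ac) (hnb : 0 < nb) (hb : 0 < b) (hbc : 0 < bc) (hnc : 0 < nc)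
    (hn : a + 2 * ab + 2 * ac + nb + b + 2 * bc + nc ≤ n) :
    IsSignedInvolution n (oddExt (twoDescentHalf a ab ac nb b bc nc)) := by
  have hcases := twoDescentHalf_cases a ab ac nb b bc nc
  simp only at hcases
  apply isSignedInvolution_oddExt
  · have := hcases 0
    omega
  · intro x hx
    have h := hcases (twoDescentHalf a ab ac nb b bc nc x)
    rcases hcases x with h' | h' | h' | h' | h' | h' | h' | h' | h' | h' | h' <;> omega
  · intro x hx hxn
    have := hcases x
    omega
  · intro x hx
    have := hcases x
    omega

theorem desB_oddExt_twoDescentHalf {n : ℕ} {a ab ac nb b bc nc : ℕ} (ha : 0 < a)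
    (hab : 0 < ab) (hac : 0 < ac) (hnb : 0 < nb) (hb : 0 < b) (hbc : 0 < bc) (hnc : 0 < nc)
    (hn : a + 2 * ab + 2 * ac + nb + b + 2 * bc + nc ≤ n) :
    desB n (oddExt (twoDescentHalf a ab ac nb b bc nc)) = 2 := by
  have hcases := twoDescentHalf_cases a ab ac nb b bc nc
  simp only at hcases
  have : (Finset.range n).filter (fun i : ℕ =>
      rlt (oddExt (twoDescentHalf a ab ac nb b bc nc) ((i : ℤ) + 1))
        (oddExt (twoDescentHalf a ab ac nb b bc nc) (i : ℤ))) =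
      {a + ab + ac, a + 2 * ab + ac + nb + b + bc} := by
    ext i
    rw [Finset.mem_filter, oddExt_of_nonneg _ (by omega), oddExt_of_nonneg _ (by omega),
      Finset.mem_range, Finset.mem_insert, Finset.mem_singleton]
    have h := hcases (i + 1)
    unfold rlt
    rcases hcases i with h' | h' | h' | h' | h' | h' | h' | h' | h' | h' | h' <;> omega
  rw [desB, this, Finset.card_pair (by omega)]

theorem eq_of_first_positive {P : ℤ → Prop} {r s t : ℤ} (hs : ∀ x, r < x → x ≤ s → ¬ P x)
    (hs' : P (s + 1)) (ht : ∀ x, r < x → x ≤ t → ¬ P x) (ht' : P (t + 1)) (hrs : r ≤ s)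
    (hrt : r ≤ t) : s = t := by
  rcases lt_trichotomy s t with h | h | h
  · exact absurd hs' (ht _ (by omega) (by omega))
  · exact h
  · exact absurd ht' (hs _ (by omega) (by omega))

theorem twoDescentHalf_injective {a ab ac nb b bc nc a' ab' ac' nb' b' bc' nc' : ℤ}
    (ha : 0 < a) (hab : 0 < ab) (hac : 0 < ac) (hnb : 0 < nb) (hb : 0 < b) (hbc : 0 < bc)
    (hnc : 0 < nc) (ha' : 0 < a') (hab' : 0 < ab') (hac' : 0 < ac') (hnb' : 0 < nb')
    (hb' : 0 < b') (hbc' : 0 < bc') (hnc' : 0 < nc')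
    (h : twoDescentHalf a ab ac nb b bc nc = twoDescentHalf a' ab' ac' nb' b' bc' nc') :
    a = a' ∧ ab = ab' ∧ ac = ac' ∧ nb = nb' ∧ b = b' ∧ bc = bc' ∧ nc = nc' := by
  have hL := twoDescentHalf_cases a ab ac nb b bc nc
  have hR := twoDescentHalf_cases a' ab' ac' nb' b' bc' nc'
  rw [← h] at hR
  generalize twoDescentHalf a ab ac nb b bc nc = f at hL hR
  simp only at hL hR
  have e1 : a =
      a' := by
    refine eq_of_first_positive (P := fun x => f x ≠ x) (r := 0) (fun x _ _ => ?_) ?_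
      (fun x _ _ => ?_) ?_ (by omega) (by omega)
    · have := hL x; omega
    · have := hL (a + 1); omega
    · have := hR x; omega
    · have := hR (a' + 1); omega
  have e2 : a + ab + ac =
      a' + ab' + ac' := by
    refine eq_of_first_positive (P := fun x => f x < 0) (r := 0) (fun x _ _ => ?_) ?_
      (fun x _ _ => ?_) ?_ (by omega) (by omega)
    · have := hL x; omega
    · have := hL (a + ab + ac + 1); omega
    · have := hR x; omega
    · have := hR (a' + ab' + ac' + 1); omega
  have e3 : a + ab + ac + nb =
      a' + ab' + ac' + nb' := by
    refine eq_of_first_positive (P := fun x => 0 < f x) (r := a + ab + ac) (fun x _ _ => ?_) ?_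
      (fun x _ _ => ?_) ?_ (by omega) (by omega)
    · have := hL x; omega
    · have := hL (a + ab + ac + nb + 1); omega
    · have := hR x; omega
    · have := hR (a' + ab' + ac' + nb' + 1); omega
  have e4 : a + 2 * ab + ac + nb =
      a' + 2 * ab' + ac' + nb' := by
    refine eq_of_first_positive (P := fun x => x ≤ f x) (r := a + ab + ac) (fun x _ _ => ?_) ?_
      (fun x _ _ => ?_) ?_ (by omega) (by omega)
    · have := hL x; omega
    · have := hL (a + 2 * ab + ac + nb + 1); omega
    · have := hR x; omega
    · have := hR (a' + 2 * ab' + ac' + nb' + 1); omega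
  have e5 : a + 2 * ab + ac + nb + b =
      a' + 2 * ab' + ac' + nb' + b' := by
    refine eq_of_first_positive (P := fun x => x < f x) (r := a + ab + ac) (fun x _ _ => ?_) ?_
      (fun x _ _ => ?_) ?_ (by omega) (by omega)
    · have := hL x; omega
    · have := hL (a + 2 * ab + ac + nb + b + 1); omega
    · have := hR x; omega
    · have := hR (a' + 2 * ab' + ac' + nb' + b' + 1); omega
  have e6 : a + 2 * ab + ac + nb + b + bc =
      a' + 2 * ab' + ac' + nb' + b' + bc' := by
    refine eq_of_first_positive (P := fun x => f x < 0) (r := a + 2 * ab + ac + nb + b)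
      (fun x _ _ => ?_) ?_ (fun x _ _ => ?_) ?_ (by omega) (by omega)
    · have := hL x; omega
    · have := hL (a + 2 * ab + ac + nb + b + bc + 1); omega
    · have := hR x; omega
    · have := hR (a' + 2 * ab' + ac' + nb' + b' + bc' + 1); omega
  have e7 : a + 2 * ab + ac + nb + b + bc + nc =
      a' + 2 * ab' + ac' + nb' + b' + bc' + nc' := by
    refine eq_of_first_positive (P := fun x => 0 < f x) (r := a + 2 * ab + ac + nb + b + bc)
      (fun x _ _ => ?_) ?_ (fun x _ _ => ?_) ?_ (by omega) (by omega)
    · have := hL x; omega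
    · have := hL (a + 2 * ab + ac + nb + b + bc + nc + 1); omega
    · have := hR x; omega
    · have := hR (a' + 2 * ab' + ac' + nb' + b' + bc' + nc' + 1); omega
  omega

theorem pow_seven_le_InkB_two (m : ℕ) : m ^ 7 ≤ InkB (10 * m) 2 := by
  let F : (Fin 7 → Fin m) → ℤ → ℤ := fun t =>
    oddExt (twoDescentHalf (t 0 + 1 : ℕ) (t 1 + 1 : ℕ) (t 2 + 1 : ℕ) (t 3 + 1 : ℕ) (t 4 + 1 : ℕ)
      (t 5 + 1 : ℕ) (t 6 + 1 : ℕ))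
  have hF : Function.Injective F := by
    intro t u htu
    have h : twoDescentHalf (t 0 + 1 : ℕ) (t 1 + 1 : ℕ) (t 2 + 1 : ℕ) (t 3 + 1 : ℕ)
        (t 4 + 1 : ℕ) (t 5 + 1 : ℕ) (t 6 + 1 : ℕ) =
        twoDescentHalf (u 0 + 1 : ℕ) (u 1 + 1 : ℕ) (u 2 + 1 : ℕ) (u 3 + 1 : ℕ)
          (u 4 + 1 : ℕ) (u 5 + 1 : ℕ) (u 6 + 1 : ℕ) := by
      funext x
      rcases le_total 0 x with hx | hx
      · have := congrFun htu x
        simpa only [F, oddExt_of_nonneg _ hx] using this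
      · rw [twoDescentHalf, twoDescentHalf, if_pos (by omega), if_pos (by omega)]
    obtain ⟨h0, h1, h2, h3, h4, h5, h6⟩ := twoDescentHalf_injective (by omega) (by omega)
      (by omega) (by omega) (by omega) (by omega) (by omega) (by omega) (by omega) (by omega)
      (by omega) (by omega) (by omega) (by omega) h
    funext k
    fin_cases k <;> apply Fin.ext <;>
      simp only [Fin.reduceFinMk, Fin.zero_eta, Fin.mk_one] <;> omega
  have hsub : Set.range F ⊆ {w | IsSignedInvolution (10 * m) w ∧ desB (10 * m) w = 2} := by
    rintro _ ⟨t, rfl⟩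
    have h := fun k => (t k).isLt
    have hn : (t 0 + 1 : ℕ) + 2 * (t 1 + 1 : ℕ) + 2 * (t 2 + 1 : ℕ) + (t 3 + 1 : ℕ) +
        (t 4 + 1 : ℕ) + 2 * (t 5 + 1 : ℕ) + (t 6 + 1 : ℕ) ≤ 10 * m := by
      linarith [h 0, h 1, h 2, h 3, h 4, h 5, h 6]
    refine ⟨isSignedInvolution_oddExt_twoDescentHalf ?_ ?_ ?_ ?_ ?_ ?_ ?_ (by exact_mod_cast hn),
      desB_oddExt_twoDescentHalf ?_ ?_ ?_ ?_ ?_ ?_ ?_ hn⟩ <;> omega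
  calc m ^ 7 = (Set.range F).ncard := by
        rw [← Set.image_univ, Set.ncard_image_of_injective _ hF, Set.ncard_univ]
        simp
    _ ≤ InkB (10 * m) 2 := Set.ncard_le_ncard hsub (finite_setOf_desB_eq _ _)

/-- Proposition 5.1: the sequence `I_{n,0}^B, …, I_{n,n}^B` is not log-concave in general: there
exist a positive integer `n` and an index `1 ≤ k ≤ n - 1` with
`(I_{n,k}^B)² < I_{n,k-1}^B ⬝ I_{n,k+1}^B`. -/
theorem InkB_not_log_concave :
    ∃ n k : ℕ, 1 ≤ n ∧ 1 ≤ k ∧ k ≤ n - 1 ∧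
      (InkB n k) ^ 2 < InkB n (k - 1) * InkB n (k + 1) := by
  refine ⟨10 * 10 ^ 7, 1, by norm_num, le_rfl, by norm_num, ?_⟩
  have h0 := InkB_zero_pos (10 * 10 ^ 7)
  have h1 := InkB_one_le (10 * 10 ^ 7)
  have h2 := pow_seven_le_InkB_two (10 ^ 7)
  calc InkB (10 * 10 ^ 7) 1 ^ 2 ≤ ((10 * 10 ^ 7 + 1) ^ 3) ^ 2 := Nat.pow_le_pow_left h1 2
    _ < 1 * (10 ^ 7) ^ 7 := by norm_num
    _ ≤ InkB (10 * 10 ^ 7) 0 * InkB (10 * 10 ^ 7) 2 := Nat.mul_le_mul h0 h2
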